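/- arXiv:0912.0555 — 2 statements merged into one kernel-verified Lean document; each statement's English description precedes it below -/
import Mathlib

section
/- Bisimilarity is a congruence for tensor in the wire calculus: if P, Q : (k,l) and R : (m,n) are closed sorted terms and P ∼ Q, then P⊗R ∼ Q⊗R and R⊗P ∼ R⊗Q. -/
/-!
# The wire calculus

Signals are drawn from an alphabet `Sig`; a label letter is `Option Sig`,
where `none` represents `ι` (absence of signal) and `some σ` a signal `σ ∈ Σ`.
Labels of transitions are pairs of words (lists) of such letters.
-/

namespace WireCalc

/-- Prefix atoms. `fvar n` is a free occurrence of the signal variable `n`,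
`bvar n` is a binding occurrence `λn`, and `const a` is a constant:
`const none` is `ι` and `const (some σ)` is the signal `σ ∈ Σ`. -/
inductive Atom (Sig : Type) : Type
  | fvar : ℕ → Atom Sig
  | bvar : ℕ → Atom Sig
  | const : Option Sig → Atom Sig

/-- Wire calculus terms. Process variables are de Bruijn indices;
`mu k l P` is `μY:(k,l).P`, binding index `0` in `P`.
`pre u v P` is the prefix `u/v.P`. -/
inductive Term (Sig : Type) : Type
  | pvar : ℕ → Term Sig
  | seq : Term Sig → Term Sig → Term Sig
  | ten : Term Sig → Term Sig → Term Sig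
  | pre : List (Atom Sig) → List (Atom Sig) → Term Sig → Term Sig
  | choice : Term Sig → Term Sig → Term Sig
  | mu : ℕ → ℕ → Term Sig → Term Sig

variable {Sig : Type}

def Atom.isBindOf (n : ℕ) : Atom Sig → Bool
  | .bvar m => m = n
  | _ => false

def Atom.isFreeOf (n : ℕ) : Atom Sig → Bool
  | .fvar m => m = n
  | _ => false

def Atom.isFvar : Atom Sig → Bool
  | .fvar _ => true
  | _ => false

/-- The signal variable `n` is bound by the prefix `u/v`
(i.e. `λn` occurs in `uv`). -/
def boundIn (n : ℕ) (u v : List (Atom Sig)) : Bool := (u ++ v).any (Atom.isBindOf n)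

/-- The signal variable `n` occurs freely in the prefix `u/v`. -/
def freeIn (n : ℕ) (u v : List (Atom Sig)) : Bool := (u ++ v).any (Atom.isFreeOf n)

/-- `bd(u/v)`: the set of signal variables bound by the prefix `u/v`. -/
def bdSet (u v : List (Atom Sig)) : Set ℕ := {n | boundIn n u v}

/-- `fr(u/v)`: the set of signal variables occurring freely in the prefix `u/v`. -/
def frSet (u v : List (Atom Sig)) : Set ℕ := {n | freeIn n u v}

/-- Substitution of constants for free signal variables in an atom.
`σ n = some a` means `n` is replaced by the constant `a`. -/
def Atom.substS (σ : ℕ → Option (Option Sig)) : Atom Sig → Atom Sig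
  | .fvar n =>
      match σ n with
      | some a => .const a
      | none => .fvar n
  | .bvar n => .bvar n
  | .const a => .const a

/-- Substitution of constants for free signal variables in a term;
variables bound by an inner prefix are shadowed and not substituted
under that prefix. -/
def Term.substS (σ : ℕ → Option (Option Sig)) : Term Sig → Term Sig
  | .pvar i => .pvar i
  | .seq P Q => .seq (P.substS σ) (Q.substS σ)
  | .ten P Q => .ten (P.substS σ) (Q.substS σ)
  | .pre u v P => .pre (u.map (Atom.substS σ)) (v.map (Atom.substS σ))
      (P.substS fun n => if boundIn n u v then none else σ n)
  | .choice P Q => .choice (P.substS σ) (Q.substS σ)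
  | .mu k l P => .mu k l (P.substS σ)

/-- Shifting of process variables `≥ c` by `d` (standard de Bruijn machinery). -/
def shiftP (d : ℕ) : ℕ → Term Sig → Term Sig
  | c, .pvar i => .pvar (if c ≤ i then i + d else i)
  | c, .seq P Q => .seq (shiftP d c P) (shiftP d c Q)
  | c, .ten P Q => .ten (shiftP d c P) (shiftP d c Q)
  | c, .pre u v P => .pre u v (shiftP d c P)
  | c, .choice P Q => .choice (shiftP d c P) (shiftP d c Q)
  | c, .mu k l P => .mu k l (shiftP d (c + 1) P)

/-- Capture-avoiding substitution `substP j S P = P[S / (pvar j)]` of a term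
for a process variable. -/
def substP : ℕ → Term Sig → Term Sig → Term Sig
  | j, S, .pvar i => if i = j then S else if j < i then .pvar (i - 1) else .pvar i
  | j, S, .seq P Q => .seq (substP j S P) (substP j S Q)
  | j, S, .ten P Q => .ten (substP j S P) (substP j S Q)
  | j, S, .pre u v P => .pre u v (substP j S P)
  | j, S, .choice P Q => .choice (substP j S P) (substP j S Q)
  | j, S, .mu k l P => .mu k l (substP (j + 1) (shiftP 1 0 S) P)

/-- The sorting judgement `Sorted Γ Δ P k l`, i.e. `Γ; Δ ⊢ P : (k, l)`,
where `Γ` is the (de Bruijn) context of process variables with their sorts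
and `Δ` the set of signal variables in scope. -/
inductive Sorted : List (ℕ × ℕ) → Set ℕ → Term Sig → ℕ → ℕ → Prop
  | pvar {Γ : List (ℕ × ℕ)} {Δ : Set ℕ} {i k l} :
      Γ[i]? = some (k, l) → Sorted Γ Δ (.pvar i) k l
  | seq {Γ Δ P Q k n l} : Sorted Γ Δ P k n → Sorted Γ Δ Q n l →
      Sorted Γ Δ (.seq P Q) k l
  | ten {Γ Δ P Q k l m n} : Sorted Γ Δ P k l → Sorted Γ Δ Q m n →
      Sorted Γ Δ (.ten P Q) (k + m) (l + n)
  | pre {Γ Δ u v P k l} : u.length = k → v.length = l →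
      frSet u v ∩ bdSet u v = ∅ → frSet u v ⊆ Δ →
      Sorted Γ (Δ ∪ bdSet u v) P k l → Sorted Γ Δ (.pre u v P) k l
  | choice {Γ Δ P Q k l} : Sorted Γ Δ P k l → Sorted Γ Δ Q k l →
      Sorted Γ Δ (.choice P Q) k l
  | mu {Γ Δ P k' l' k l} : Sorted ((k', l') :: Γ) Δ P k l →
      Sorted Γ Δ (.mu k' l' P) k l

/-- The word `ι⃗` of length `k`, consisting solely of `ι`'s. -/
def iotaW (Sig : Type) (k : ℕ) : List (Option Sig) := List.replicate k none

/-- A word consists solely of `ι`'s. -/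
def IsIota (w : List (Option Sig)) : Prop := ∀ x ∈ w, x = none

/-- Instantiation of a prefix atom to a label letter along a substitution `σ`
of the bound signal variables. -/
def instAtom (σ : ℕ → Option Sig) : Atom Sig → Option Sig
  | .fvar n => σ n
  | .bvar n => σ n
  | .const a => a

/-- The operational semantics of the wire calculus: `Step P a b Q` means
`P →[a/b] Q`.  The rules are Refl, ιL, ιR, Cut, Ten, Pref, +ι, +L, +R, Rec. -/
inductive Step : Term Sig → List (Option Sig) → List (Option Sig) → Term Sig → Prop
  | refl {P : Term Sig} {k l : ℕ} :
      Sorted [] ∅ P k l → Step P (iotaW Sig k) (iotaW Sig l) P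
  | iotaL {P R Q : Term Sig} {a' b' a b} :
      IsIota a' → IsIota b' → Step P a' b' R → Step R a b Q → Step P a b Q
  | iotaR {P R Q : Term Sig} {a b a' b'} :
      Step P a b R → IsIota a' → IsIota b' → Step R a' b' Q → Step P a b Q
  | cut {P Q R S : Term Sig} {a b c} :
      Step P a c Q → Step R c b S → Step (.seq P R) a b (.seq Q S)
  | ten {P Q R S : Term Sig} {a b c d} :
      Step P a b Q → Step R c d S → Step (.ten P R) (a ++ c) (b ++ d) (.ten Q S)
  | pref {u v : List (Atom Sig)} {P : Term Sig} (σ : ℕ → Option Sig)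
      (hnofree : ∀ x ∈ u ++ v, x.isFvar = false) :
      Step (.pre u v P) (u.map (instAtom σ)) (v.map (instAtom σ))
        (P.substS fun n => if boundIn n u v then some (σ n) else none)
  | choiceIota {P Q R S : Term Sig} {a b} :
      IsIota a → IsIota b → Step P a b Q → Step R a b S →
      Step (.choice P R) a b (.choice Q S)
  | choiceL {P Q R : Term Sig} {a b} :
      ¬ IsIota (a ++ b) → Step P a b Q → Step (.choice P R) a b Q
  | choiceR {P Q R : Term Sig} {a b} :
      ¬ IsIota (a ++ b) → Step R a b Q → Step (.choice P R) a b Q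
  | recur {k l : ℕ} {P Q : Term Sig} {a b} :
      Step (substP 0 (.mu k l P) P) a b Q → Step (.mu k l P) a b Q

/-- A chain of transitions with the given list of labels. -/
inductive MultiStep :
    Term Sig → List (List (Option Sig) × List (Option Sig)) → Term Sig → Prop
  | nil (P : Term Sig) : MultiStep P [] P
  | cons {P Q R : Term Sig} {a b ls} :
      Step P a b Q → MultiStep Q ls R → MultiStep P ((a, b) :: ls) R

/-- `S` is a simulation on the LTS of the wire calculus. -/
def IsSim (S : Term Sig → Term Sig → Prop) : Prop :=
  ∀ P Q, S P Q → ∀ a b P', Step P a b P' → ∃ Q', Step Q a b Q' ∧ S P' Q'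

/-- (Strong) bisimilarity `P ∼ Q` of wire calculus terms: some relation
containing `(P, Q)` is a bisimulation, i.e. it and its inverse are simulations. -/
def Bisim (P Q : Term Sig) : Prop :=
  ∃ S : Term Sig → Term Sig → Prop, IsSim S ∧ IsSim (flip S) ∧ S P Q

/-! ## Wire constants -/

/-- The word of binders `λx₁…λxₘ`. -/
def bindW (Sig : Type) (m : ℕ) : List (Atom Sig) := (List.range m).map Atom.bvar

/-- The `m`-fold identity wire `Iₘ := μY.(λx₁…λxₘ/λx₁…λxₘ).Y : (m,m)`. -/
def idW (Sig : Type) (m : ℕ) : Term Sig :=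
  .mu m m (.pre (bindW Sig m) (bindW Sig m) (.pvar 0))

/-- The symmetry (twist) wire
`X_{k,l} := μY.(λx₁…λxₖλy₁…λyₗ / λy₁…λyₗλx₁…λxₖ).Y : (k+l, l+k)`. -/
def twistW (Sig : Type) (k l : ℕ) : Term Sig :=
  .mu (k + l) (l + k)
    (.pre (bindW Sig k ++ ((List.range l).map fun i => Atom.bvar (k + i)))
          (((List.range l).map fun i => Atom.bvar (k + i)) ++ bindW Sig k)
          (.pvar 0))

/-- The wire constant `d := μY.(ε/λxλx).Y : (0,2)`. -/
def dW (Sig : Type) : Term Sig := .mu 0 2 (.pre [] [.bvar 0, .bvar 0] (.pvar 0))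

/-- The wire constant `e := μY.(λxλx/ε).Y : (2,0)`. -/
def eW (Sig : Type) : Term Sig := .mu 2 0 (.pre [.bvar 0, .bvar 0] [] (.pvar 0))

/-- The trivial term `0 := μY.Y : (0,0)`. -/
def zeroW (Sig : Type) : Term Sig := .mu 0 0 (.pvar 0)

/-- `dₙ : (0,2n)`, recursively: `d₀ := 0`, `d₁ := d`, `d_{n+1} := d;(I⊗dₙ⊗I)`. -/
def dN (Sig : Type) : ℕ → Term Sig
  | 0 => zeroW Sig
  | 1 => dW Sig
  | n + 2 => .seq (dW Sig) (.ten (.ten (idW Sig 1) (dN Sig (n + 1))) (idW Sig 1))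

/-- `eₙ : (2n,0)`, recursively: `e₀ := 0`, `e₁ := e`, `e_{n+1} := (Iₙ⊗e⊗Iₙ);eₙ`. -/
def eN (Sig : Type) : ℕ → Term Sig
  | 0 => zeroW Sig
  | 1 => eW Sig
  | n + 2 => .seq (.ten (.ten (idW Sig (n + 1)) (eW Sig)) (idW Sig (n + 1)))
      (eN Sig (n + 1))

/-- `Iₙ` with the convention `I₀ := 0`. -/
def IN (Sig : Type) : ℕ → Term Sig
  | 0 => zeroW Sig
  | n + 1 => idW Sig (n + 1)

/-- The dualizing transformation `(-)*`; on prefix strings it is reversal. -/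
def Term.star : Term Sig → Term Sig
  | .pvar i => .pvar i
  | .seq P Q => .seq Q.star P.star
  | .ten P Q => .ten Q.star P.star
  | .pre u v P => .pre v.reverse u.reverse P.star
  | .choice P Q => .choice P.star Q.star
  | .mu k l P => .mu l k P.star

end WireCalc


namespace WireCalc

/-- Every transition of a tensor splits into transitions of its two factors. -/
theorem Step.ten_inv {Sig : Type} {T T' : Term Sig} {x y : List (Option Sig)}
    (h : Step T x y T') : ∀ {P R : Term Sig}, T = .ten P R →
      ∃ a b c d P' R', Step P a b P' ∧ Step R c d R' ∧
        x = a ++ c ∧ y = b ++ d ∧ T' = .ten P' R' := by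
  induction h with
  | refl hs =>
    rintro P R rfl
    cases hs with
    | ten hP hR =>
      exact ⟨_, _, _, _, _, _, .refl hP, .refl hR,
        List.replicate_add .., List.replicate_add .., rfl⟩
  | iotaL ha hb _ _ ih₁ ih₂ =>
    intro P R hT
    obtain ⟨a, b, c, d, P', R', hP, hR, rfl, rfl, rfl⟩ := ih₁ hT
    obtain ⟨a₂, b₂, c₂, d₂, P'', R'', hP₂, hR₂, rfl, rfl, rfl⟩ := ih₂ rfl
    simp only [IsIota, List.forall_mem_append] at ha hb
    exact ⟨_, _, _, _, _, _, .iotaL ha.1 hb.1 hP hP₂, .iotaL ha.2 hb.2 hR hR₂,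
      rfl, rfl, rfl⟩
  | iotaR _ ha hb _ ih₁ ih₂ =>
    intro P R hT
    obtain ⟨a, b, c, d, P', R', hP, hR, rfl, rfl, rfl⟩ := ih₁ hT
    obtain ⟨a₂, b₂, c₂, d₂, P'', R'', hP₂, hR₂, rfl, rfl, rfl⟩ := ih₂ rfl
    simp only [IsIota, List.forall_mem_append] at ha hb
    exact ⟨_, _, _, _, _, _, .iotaR hP ha.1 hb.1 hP₂, .iotaR hR ha.2 hb.2 hR₂,
      rfl, rfl, rfl⟩
  | ten hP hR =>
    intro P R hT
    cases hT
    exact ⟨_, _, _, _, _, _, hP, hR, rfl, rfl, rfl⟩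
  | _ => intro P R hT; cases hT

/-- The relation between tensors whose factors are related by `S₁` and `S₂`. -/
inductive TenRel {Sig : Type} (S₁ S₂ : Term Sig → Term Sig → Prop) :
    Term Sig → Term Sig → Prop
  | mk {P Q R T : Term Sig} : S₁ P Q → S₂ R T → TenRel S₁ S₂ (.ten P R) (.ten Q T)

theorem IsSim.tenRel {Sig : Type} {S₁ S₂ : Term Sig → Term Sig → Prop}
    (h₁ : IsSim S₁) (h₂ : IsSim S₂) : IsSim (TenRel S₁ S₂) := by
  rintro _ _ ⟨hPQ, hRT⟩ x y X hX
  obtain ⟨a, b, c, d, P', R', hP, hR, rfl, rfl, rfl⟩ := hX.ten_inv rfl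
  obtain ⟨Q', hQ, hPQ'⟩ := h₁ _ _ hPQ _ _ _ hP
  obtain ⟨T', hT, hRT'⟩ := h₂ _ _ hRT _ _ _ hR
  exact ⟨_, .ten hQ hT, .mk hPQ' hRT'⟩

theorem flip_tenRel {Sig : Type} (S₁ S₂ : Term Sig → Term Sig → Prop) :
    flip (TenRel S₁ S₂) = TenRel (flip S₁) (flip S₂) := by
  ext X Y
  constructor <;> rintro ⟨h₁, h₂⟩ <;> exact ⟨h₁, h₂⟩

theorem Bisim.refl {Sig : Type} (P : Term Sig) : Bisim P P :=
  ⟨Eq, fun _ _ h _ _ _ hs => ⟨_, h ▸ hs, rfl⟩,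
    fun _ _ h _ _ _ hs => ⟨_, Eq.symm h ▸ hs, rfl⟩, rfl⟩

theorem Bisim.ten {Sig : Type} {P Q R T : Term Sig} (h₁ : Bisim P Q) (h₂ : Bisim R T) :
    Bisim (.ten P R) (.ten Q T) := by
  obtain ⟨S₁, hS₁, hS₁', hPQ⟩ := h₁
  obtain ⟨S₂, hS₂, hS₂', hRT⟩ := h₂
  exact ⟨TenRel S₁ S₂, hS₁.tenRel hS₂, flip_tenRel S₁ S₂ ▸ hS₁'.tenRel hS₂', .mk hPQ hRT⟩

/-- bisimilarity is a congruence for tensor. -/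
theorem bisim_congr_ten {Sig : Type} {P Q R : Term Sig} {k l m n : ℕ}
    (hP : Sorted [] ∅ P k l) (hQ : Sorted [] ∅ Q k l)
    (hR : Sorted [] ∅ R m n)
    (h : Bisim P Q) :
    Bisim (.ten P R) (.ten Q R) ∧ Bisim (.ten R P) (.ten R Q) :=
  ⟨h.ten (.refl R), (Bisim.refl R).ten h⟩

end WireCalc
end

section
/- Bisimilarity is a congruence for prefix in the wire calculus: if P, Q : (k,l) are sorted terms (possibly with free signal variables bound by the prefix) with P ∼ Q under all closing substitutions, and u/v is a well-formed prefix with |u|=k, |v|=l, then u/v.P ∼ u/v.Q. -/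
namespace WireCalc

theorem Bisim.symm {Sig : Type} {P Q : Term Sig} : Bisim P Q → Bisim Q P :=
  fun ⟨S, hS, hS', h⟩ => ⟨flip S, hS', hS, h⟩

theorem Bisim.exists_step {Sig : Type} {P Q P' : Term Sig} {a b : List (Option Sig)}
    (h : Bisim P Q) (hs : Step P a b P') : ∃ Q', Step Q a b Q' ∧ Bisim P' Q' := by
  obtain ⟨S, hS, hS', h⟩ := h
  obtain ⟨Q', hQ', hr⟩ := hS P Q h a b P' hs
  exact ⟨Q', hQ', S, hS, hS', hr⟩

theorem Sorted.length_pre {Sig : Type} {Γ : List (ℕ × ℕ)} {Δ : Set ℕ} {P : Term Sig}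
    {u v : List (Atom Sig)} {k l : ℕ} (h : Sorted Γ Δ (.pre u v P) k l) :
    u.length = k ∧ v.length = l := by
  cases h with
  | pre hu hv => exact ⟨hu, hv⟩

/-- Every transition of `u/v.P` is matched by `u/v.Q`, up to bisimilarity or the pair itself. -/
theorem Step.match_pre {Sig : Type} {P Q X X' : Term Sig} {u v : List (Atom Sig)} {k l : ℕ}
    {a b : List (Option Sig)} (hQ : Sorted [] ∅ (.pre u v Q) k l)
    (h : ∀ σ : ℕ → Option Sig,
      Bisim (P.substS fun n => if boundIn n u v then some (σ n) else none)
            (Q.substS fun n => if boundIn n u v then some (σ n) else none))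
    (hs : Step X a b X') (hX : X = .pre u v P) :
    ∃ Y', Step (.pre u v Q) a b Y' ∧ (X' = .pre u v P ∧ Y' = .pre u v Q ∨ Bisim X' Y') := by
  induction hs with
  | refl hsort =>
    subst hX
    obtain ⟨rfl, rfl⟩ := hsort.length_pre
    obtain ⟨rfl, rfl⟩ := hQ.length_pre
    exact ⟨_, .refl hQ, .inl ⟨rfl, rfl⟩⟩
  | iotaL ha hb _ hs₂ ih₁ ih₂ =>
    obtain ⟨R', hR', ⟨hR, rfl⟩ | hR⟩ := ih₁ hX
    · exact ih₂ hR
    · obtain ⟨Y', hY', hr⟩ := hR.exists_step hs₂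
      exact ⟨Y', .iotaL ha hb hR' hY', .inr hr⟩
  | iotaR _ ha hb hs₂ ih₁ ih₂ =>
    obtain ⟨R', hR', ⟨hR, rfl⟩ | hR⟩ := ih₁ hX
    · obtain ⟨Y', hY', hr⟩ := ih₂ hR
      exact ⟨Y', .iotaR hR' ha hb hY', hr⟩
    · obtain ⟨Y', hY', hr⟩ := hR.exists_step hs₂
      exact ⟨Y', .iotaR hR' ha hb hY', .inr hr⟩
  | pref σ hnofree =>
    cases hX
    exact ⟨_, .pref σ hnofree, .inr (h σ)⟩
  | _ => cases hX

/-- bisimilarity is a congruence for prefix: if `u/v.P` and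
`u/v.Q` are well-sorted (closed) terms of sort `(k,l)` and `P ∼ Q` under every
closing substitution of the signal variables bound by the prefix `u/v`, then
`u/v.P ∼ u/v.Q`. -/
theorem bisim_congr_pre {Sig : Type} {P Q : Term Sig}
    {u v : List (Atom Sig)} {k l : ℕ}
    (hP : Sorted [] ∅ (.pre u v P) k l) (hQ : Sorted [] ∅ (.pre u v Q) k l)
    (h : ∀ σ : ℕ → Option Sig,
      Bisim (P.substS fun n => if boundIn n u v then some (σ n) else none)
            (Q.substS fun n => if boundIn n u v then some (σ n) else none)) :
    Bisim (.pre u v P) (.pre u v Q) := by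
  refine ⟨fun X Y => X = .pre u v P ∧ Y = .pre u v Q ∨ Bisim X Y, ?_, ?_, .inl ⟨rfl, rfl⟩⟩
  · rintro X Y (⟨rfl, rfl⟩ | hXY) a b X' hs
    · exact hs.match_pre hQ h rfl
    · obtain ⟨Y', hY', hr⟩ := hXY.exists_step hs
      exact ⟨Y', hY', .inr hr⟩
  · rintro Y X (⟨rfl, rfl⟩ | hXY) a b Y' hs
    · obtain ⟨X', hX', hr⟩ := hs.match_pre hP (fun σ => (h σ).symm) rfl
      exact ⟨X', hX', hr.imp And.symm Bisim.symm⟩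
    · obtain ⟨X', hX', hr⟩ := hXY.symm.exists_step hs
      exact ⟨X', hX', .inr hr.symm⟩

end WireCalc
end
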